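/- For all integers k ≥ 1 and m ≥ 1, the polynomials x^k·y^m and x^k·y^{m−1}·z belong to L. -/

import Mathlib

open MvPolynomial

/-- The defining polynomial `f = x² + y² + z² + Exyz − Ax − By − Cz − D` of the
Markov-type surface. -/
noncomputable def markovPoly (A B C D E : ℂ) : MvPolynomial (Fin 3) ℂ :=
  X 0 ^ 2 + X 1 ^ 2 + X 2 ^ 2 + MvPolynomial.C E * X 0 * X 1 * X 2
    - MvPolynomial.C A * X 0 - MvPolynomial.C B * X 1 - MvPolynomial.C C * X 2
    - MvPolynomial.C D

/-- The Poisson bracket on `ℂ[x,y,z]` induced by the Markov-type surface: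
`{g,h} = f_x·(g_y h_z − g_z h_y) + f_y·(g_z h_x − g_x h_z) + f_z·(g_x h_y − g_y h_x)`,
where `f` is the defining polynomial of the surface. -/
noncomputable def markovBracket (A B C D E : ℂ) (g h : MvPolynomial (Fin 3) ℂ) :
    MvPolynomial (Fin 3) ℂ :=
  pderiv 0 (markovPoly A B C D E) * (pderiv 1 g * pderiv 2 h - pderiv 2 g * pderiv 1 h)
  + pderiv 1 (markovPoly A B C D E) * (pderiv 2 g * pderiv 0 h - pderiv 0 g * pderiv 2 h)
  + pderiv 2 (markovPoly A B C D E) * (pderiv 0 g * pderiv 1 h - pderiv 1 g * pderiv 0 h)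

section BracketOfPowers

variable (A B C D E : ℂ) (a b : ℕ)

theorem markovBracket_X_zero_pow_X_one_pow :
    markovBracket A B C D E (X 0 ^ (a + 1)) (X 1 ^ (b + 1)) =
      (((a : ℂ) + 1) * ((b : ℂ) + 1)) • (E • (X 0 ^ (a + 1) * X 1 ^ (b + 1) * X 2 ^ 0)
        + (2 : ℂ) • (X 0 ^ a * X 1 ^ b * X 2 ^ 1) - C • (X 0 ^ a * X 1 ^ b * X 2 ^ 0)) := by
  simp [markovBracket, markovPoly, pderiv_X, smul_eq_C_mul,
    map_ofNat (MvPolynomial.C : ℂ →+* MvPolynomial (Fin 3) ℂ) 2]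
  ring

theorem markovBracket_X_one_pow_X_two_pow :
    markovBracket A B C D E (X 1 ^ (a + 1)) (X 2 ^ (b + 1)) =
      (((a : ℂ) + 1) * ((b : ℂ) + 1)) • (E • (X 0 ^ 0 * X 1 ^ (a + 1) * X 2 ^ (b + 1))
        + (2 : ℂ) • (X 0 ^ 1 * X 1 ^ a * X 2 ^ b) - A • (X 0 ^ 0 * X 1 ^ a * X 2 ^ b)) := by
  simp [markovBracket, markovPoly, pderiv_X, smul_eq_C_mul,
    map_ofNat (MvPolynomial.C : ℂ →+* MvPolynomial (Fin 3) ℂ) 2]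
  ring

theorem markovBracket_X_two_pow_X_zero_pow :
    markovBracket A B C D E (X 2 ^ (b + 1)) (X 0 ^ (a + 1)) =
      (((a : ℂ) + 1) * ((b : ℂ) + 1)) • (E • (X 0 ^ (a + 1) * X 1 ^ 0 * X 2 ^ (b + 1))
        + (2 : ℂ) • (X 0 ^ a * X 1 ^ 1 * X 2 ^ b) - B • (X 0 ^ a * X 1 ^ 0 * X 2 ^ b)) := by
  simp [markovBracket, markovPoly, pderiv_X, smul_eq_C_mul,
    map_ofNat (MvPolynomial.C : ℂ →+* MvPolynomial (Fin 3) ℂ) 2]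
  ring

end BracketOfPowers

theorem monomial_mul_markovPoly (A B C D E : ℂ) (a b c : ℕ) :
    X 0 ^ a * X 1 ^ b * X 2 ^ c * markovPoly A B C D E =
      E • (X 0 ^ (a + 1) * X 1 ^ (b + 1) * X 2 ^ (c + 1))
        + (X 0 ^ (a + 2) * X 1 ^ b * X 2 ^ c + X 0 ^ a * X 1 ^ (b + 2) * X 2 ^ c
          + X 0 ^ a * X 1 ^ b * X 2 ^ (c + 2) - A • (X 0 ^ (a + 1) * X 1 ^ b * X 2 ^ c)
          - B • (X 0 ^ a * X 1 ^ (b + 1) * X 2 ^ c) - C • (X 0 ^ a * X 1 ^ b * X 2 ^ (c + 1))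
          - D • (X 0 ^ a * X 1 ^ b * X 2 ^ c)) := by
  simp only [markovPoly, smul_eq_C_mul]
  ring

theorem mem_of_smul_smul_add_sub_mem {V : Type*} [AddCommGroup V] [Module ℂ V]
    {L : Submodule ℂ V} {E r s : ℂ} (hE : E ≠ 0) {a b : ℕ} {u v w : V}
    (h : (((a : ℂ) + 1) * ((b : ℂ) + 1)) • (E • u + r • v - s • w) ∈ L)
    (hv : v ∈ L) (hw : w ∈ L) : u ∈ L := by
  have hab : ((a : ℂ) + 1) * ((b : ℂ) + 1) ≠ 0 :=
    mul_ne_zero (Nat.cast_add_one_ne_zero a) (Nat.cast_add_one_ne_zero b)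
  rw [L.smul_mem_iff hab, add_sub_assoc,
    L.add_mem_iff_left (L.sub_mem (L.smul_mem r hv) (L.smul_mem s hw)), L.smul_mem_iff hE] at h
  exact h

/-- A bracket-closed subspace containing the ideal `(f)` and all powers of the coordinates
contains every monomial. -/
theorem monomial_mem_of_markovBracket_closed {A B C D E : ℂ} (hE : E ≠ 0)
    {L : Submodule ℂ (MvPolynomial (Fin 3) ℂ)}
    (hIdeal : ∀ p ∈ Ideal.span {markovPoly A B C D E}, p ∈ L)
    (hpow : ∀ (i : Fin 3) (n : ℕ), (X i : MvPolynomial (Fin 3) ℂ) ^ n ∈ L)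
    (hbr : ∀ g h : MvPolynomial (Fin 3) ℂ, g ∈ L → h ∈ L → markovBracket A B C D E g h ∈ L)
    (a b c : ℕ) : (X 0 : MvPolynomial (Fin 3) ℂ) ^ a * X 1 ^ b * X 2 ^ c ∈ L := by
  induction hn : a + b + c using Nat.strong_induction_on generalizing a b c with
  | _ n ih =>
    have ih' (i j k : ℕ) (h : i + j + k < n) :
        (X 0 : MvPolynomial (Fin 3) ℂ) ^ i * X 1 ^ j * X 2 ^ k ∈ L := ih _ h i j k rfl
    match a, b, c with
    | a, 0, 0 => simpa using hpow 0 a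
    | 0, b, 0 => simpa using hpow 1 b
    | 0, 0, c => simpa using hpow 2 c
    | a + 1, b + 1, 0 =>
      have h := hbr _ _ (hpow 0 (a + 1)) (hpow 1 (b + 1))
      rw [markovBracket_X_zero_pow_X_one_pow] at h
      exact mem_of_smul_smul_add_sub_mem hE h (ih' _ _ _ (by lia)) (ih' _ _ _ (by lia))
    | 0, b + 1, c + 1 =>
      have h := hbr _ _ (hpow 1 (b + 1)) (hpow 2 (c + 1))
      rw [markovBracket_X_one_pow_X_two_pow] at h
      exact mem_of_smul_smul_add_sub_mem hE h (ih' _ _ _ (by lia)) (ih' _ _ _ (by lia))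
    | a + 1, 0, c + 1 =>
      have h := hbr _ _ (hpow 2 (c + 1)) (hpow 0 (a + 1))
      rw [markovBracket_X_two_pow_X_zero_pow] at h
      exact mem_of_smul_smul_add_sub_mem hE h (ih' _ _ _ (by lia)) (ih' _ _ _ (by lia))
    | a + 1, b + 1, c + 1 =>
      have h := hIdeal _ (Ideal.mul_mem_left _ (X 0 ^ a * X 1 ^ b * X 2 ^ c)
        (Ideal.mem_span_singleton_self (markovPoly A B C D E)))
      rw [monomial_mul_markovPoly, L.add_mem_iff_left, L.smul_mem_iff hE] at h
      · exact h
      · exact L.sub_mem (L.sub_mem (L.sub_mem (L.sub_mem (L.add_mem (L.add_mem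
          (ih' _ _ _ (by lia)) (ih' _ _ _ (by lia))) (ih' _ _ _ (by lia)))
          (L.smul_mem _ (ih' _ _ _ (by lia)))) (L.smul_mem _ (ih' _ _ _ (by lia))))
          (L.smul_mem _ (ih' _ _ _ (by lia)))) (L.smul_mem _ (ih' _ _ _ (by lia)))

/-- For all integers `k ≥ 1` and `m ≥ 1`, the polynomials `x^k y^m` and
`x^k y^{m−1} z` belong to `L`, where `L` is the smallest ℂ-linear subspace of
`ℂ[x,y,z]` containing the ideal `(f)`, the constant `1` and all powers
`x^n, y^n, z^n` (`n ≥ 1`), and closed under the Poisson bracket. (Formalized by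
quantifying over all such subspaces `L`.) -/
theorem monomials_general_mem (A B C D E : ℂ) (hE : E ≠ 0) (k m : ℕ)
    (hk : 1 ≤ k) (hm : 1 ≤ m)
    (L : Submodule ℂ (MvPolynomial (Fin 3) ℂ))
    (hIdeal : ∀ p ∈ Ideal.span {markovPoly A B C D E}, p ∈ L)
    (hone : (1 : MvPolynomial (Fin 3) ℂ) ∈ L)
    (hxpow : ∀ m : ℕ, 1 ≤ m → (X 0 : MvPolynomial (Fin 3) ℂ) ^ m ∈ L)
    (hypow : ∀ m : ℕ, 1 ≤ m → (X 1 : MvPolynomial (Fin 3) ℂ) ^ m ∈ L)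
    (hzpow : ∀ m : ℕ, 1 ≤ m → (X 2 : MvPolynomial (Fin 3) ℂ) ^ m ∈ L)
    (hbr : ∀ g h : MvPolynomial (Fin 3) ℂ, g ∈ L → h ∈ L → markovBracket A B C D E g h ∈ L) :
    (X 0 : MvPolynomial (Fin 3) ℂ) ^ k * X 1 ^ m ∈ L ∧
    (X 0 : MvPolynomial (Fin 3) ℂ) ^ k * X 1 ^ (m - 1) * X 2 ∈ L := by
  have hpow (i : Fin 3) (n : ℕ) : (X i : MvPolynomial (Fin 3) ℂ) ^ n ∈ L := by
    rcases n.eq_zero_or_pos with rfl | hn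
    · simpa using hone
    · fin_cases i
      · exact hxpow n hn
      · exact hypow n hn
      · exact hzpow n hn
  have hmem := monomial_mem_of_markovBracket_closed hE hIdeal hpow hbr
  exact ⟨by simpa using hmem k m 0, by simpa using hmem k (m - 1) 1⟩
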